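/- Let ε be a real number with 0 < ε < 1/2, let ρ₀ be a real number with 0 ≤ ρ₀ < 1 − ε, and define ρ_{n+1} = (ρ_n + (1 − ρ_n)²)/(1 + (1 − ρ_n)²). Then there exists a natural number t with t ≤ 2ε · (1 − ε − ρ₀)/(1 − 2ε² − √(1 − 4ε²)) + 1 such that ρ_t ≥ 1 − ε. That is, the iterated ratio-improvement reaches ratio 1 − ε within a number of iterations depending only on ε and ρ₀. -/

import Mathlib

/-- If `x / (1 + x ^ 2)` is at least `ε`, then `x` is at least the smaller root `a` of
`ε * a ^ 2 - a + ε`, which bounds the decrease from `x` to `x / (1 + x ^ 2)` from below. -/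
theorem sub_le_sub_div_one_add_sq {ε a x : ℝ} (hε0 : 0 < ε) (hε1 : ε < 1 / 2)
    (ha0 : 0 < a) (ha : ε * (1 + a ^ 2) = a) (ha1 : 2 * ε * a ≤ 1)
    (hx1 : x ≤ 1) (hx : ε ≤ x / (1 + x ^ 2)) :
    a - ε ≤ x - x / (1 + x ^ 2) := by
  have hpos : 0 < 1 + x ^ 2 := by positivity
  have hx' : ε * (1 + x ^ 2) ≤ x := (le_div_iff₀ hpos).1 hx
  have hax : a ≤ x := by
    by_contra! h
    have hsum : ε * (x + a) < 1 := by nlinarith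
    nlinarith [mul_pos (sub_pos.2 h) (sub_pos.2 hsum)]
  have hdiff : x - x / (1 + x ^ 2) = x ^ 2 * (x / (1 + x ^ 2)) := by
    field_simp
    ring
  calc a - ε = a ^ 2 * ε := by linarith
    _ ≤ x ^ 2 * (x / (1 + x ^ 2)) := by gcongr
    _ = x - x / (1 + x ^ 2) := hdiff.symm

/-- The iterated ratio-improvement reaches ratio `1 − ε` within a number of
iterations depending only on `ε` and `ρ₀`. -/
theorem stmt_14 (ε : ℝ) (hε0 : 0 < ε) (hε1 : ε < 1 / 2)
    (ρ₀ : ℝ) (h0 : 0 ≤ ρ₀) (h1 : ρ₀ < 1 - ε)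
    (ρ : ℕ → ℝ) (hinit : ρ 0 = ρ₀)
    (hstep : ∀ n, ρ (n + 1) = (ρ n + (1 - ρ n) ^ 2) / (1 + (1 - ρ n) ^ 2)) :
    ∃ t : ℕ,
      (t : ℝ) ≤ 2 * ε * (1 - ε - ρ₀) / (1 - 2 * ε ^ 2 - Real.sqrt (1 - 4 * ε ^ 2)) + 1 ∧
      1 - ε ≤ ρ t := by
  set s := Real.sqrt (1 - 4 * ε ^ 2) with hs
  have hs0 : 0 ≤ s := Real.sqrt_nonneg _
  have hs2 : s ^ 2 = 1 - 4 * ε ^ 2 := Real.sq_sqrt (by nlinarith)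
  have hs1 : s < 1 := by nlinarith [sq_pos_of_pos hε0]
  obtain ⟨a, hadef⟩ : ∃ a, a = (1 - s) / (2 * ε) := ⟨_, rfl⟩
  have has : 2 * ε * a = 1 - s := by rw [hadef]; field_simp
  have ha0 : 0 < a := by rw [hadef]; exact div_pos (by linarith) (by linarith)
  have ha : ε * (1 + a ^ 2) = a := by
    refine mul_left_cancel₀ (mul_pos four_pos hε0).ne' ?_
    linear_combination (2 * ε * a - 1 - s) * has + hs2
  have hδ : 0 < a - ε := by nlinarith [mul_pos hε0 (sq_pos_of_pos ha0)]
  have hden : 1 - 2 * ε ^ 2 - s = 2 * ε * (a - ε) := by linear_combination -has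
  rw [hden, mul_div_mul_left _ _ (mul_pos two_pos hε0).ne']
  have hrec : ∀ n, 1 - ρ (n + 1) = (1 - ρ n) / (1 + (1 - ρ n) ^ 2) := fun n => by
    have : 0 < 1 + (1 - ρ n) ^ 2 := by positivity
    rw [hstep]
    field_simp
    ring
  have hle : ∀ n, ρ n ≤ 1 := fun n => by
    induction n with
    | zero => linarith
    | succ n ih =>
      have : 0 ≤ (1 - ρ n) / (1 + (1 - ρ n) ^ 2) :=
        div_nonneg (sub_nonneg.2 ih) (by positivity)
      linarith [hrec n]
  have hmono : Monotone ρ := monotone_nat_of_le_succ fun n => by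
    have : (1 - ρ n) / (1 + (1 - ρ n) ^ 2) ≤ 1 - ρ n :=
      div_le_self (sub_nonneg.2 (hle n)) (by nlinarith [sq_nonneg (1 - ρ n)])
    linarith [hrec n]
  have hgrow : ∀ n, ρ n < 1 - ε → ρ₀ + n * (a - ε) ≤ ρ n := fun n => by
    induction n with
    | zero => simp [hinit]
    | succ n ih =>
      intro h
      have hn := ih ((hmono n.le_succ).trans_lt h)
      have hn0 : 0 ≤ ρ n := h0.trans (hinit ▸ hmono n.zero_le)
      have := sub_le_sub_div_one_add_sq (x := 1 - ρ n) hε0 hε1 ha0 ha (by linarith)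
        (by linarith) (by rw [← hrec]; linarith)
      rw [← hrec] at this
      push_cast
      linarith
  refine ⟨⌊(1 - ε - ρ₀) / (a - ε)⌋₊ + 1, ?_, ?_⟩
  · push_cast
    gcongr
    exact Nat.floor_le (div_nonneg (by linarith) hδ.le)
  · by_contra! h
    have hlt := (div_lt_iff₀ hδ).1 (Nat.lt_floor_add_one ((1 - ε - ρ₀) / (a - ε)))
    have := hgrow _ h
    push_cast at this
    linarith
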